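/- Let Q be an integer with 3 ≤ Q ≤ 7, N a one-sided infinite geodesic ray in 𝔾^Q starting at a root 0, A_{ℍ^Q} := A_{𝔾^Q} + P_{ℓ²(N)}, λ* := ‖A_{ℍ^Q}‖ = (3−√5)Q/2 + √5, and S(λ) := P_{ℓ²(N)} R_{A_{𝔾^Q}}(λ) restricted to ℓ²(N). Then for λ > λ*: R_{A_{ℍ^Q}}(λ) = R_{A_{𝔾^Q}}(λ)[ I + P_{ℓ²(N)} (I_{ℓ²(N)} − S(λ))^{-1} P_{ℓ²(N)} R_{A_{𝔾^Q}}(λ) ]. Moreover A_{ℍ^Q} is transient; more precisely, lim_{λ ↓ λ*} ⟨R_{A_{ℍ^Q}}(λ) δ_0, δ_0⟩ = (1 − a(λ*))/a(λ*) < +∞, where a(λ) = λ(1 − √(1 − 4(Q−1)/λ²))/(2(Q−1)). -/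

import Mathlib

open Filter MeasureTheory Set
open scoped Topology Classical ENNReal

noncomputable section

/-- The Hilbert space ℓ²(V) with complex coefficients. -/
abbrev L2 (V : Type) := lp (fun _ : V => ℂ) 2

/-- The coordinate (delta) vector at a vertex `x`. -/
def delta {V : Type} (x : V) : L2 V :=
  haveI := Classical.decEq V; lp.single 2 x 1

/-- The matrix entry `B_{x y} = (B δ_y)(x)` of a bounded operator on ℓ²(V). -/
def entry {V : Type} (B : L2 V →L[ℂ] L2 V) (x y : V) : ℂ :=
  (B (delta y) : ∀ _ : V, ℂ) x

/-- The resolvent `R_B(z) = (z·1 − B)⁻¹` (junk value if not invertible). -/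
def Res {V : Type} (B : L2 V →L[ℂ] L2 V) (z : ℂ) : L2 V →L[ℂ] L2 V :=
  Ring.inverse (z • (1 : L2 V →L[ℂ] L2 V) - B)

/-- The resolvent at a real point. -/
def ResR {V : Type} (B : L2 V →L[ℂ] L2 V) (l : ℝ) : L2 V →L[ℂ] L2 V :=
  Res B (l : ℂ)

/-- `G` is the homogeneous Cayley tree of degree `Q`: connected, acyclic,
and every vertex has exactly `Q` neighbours. -/
structure IsCayleyTree {V : Type} (G : SimpleGraph V) (Q : ℕ) : Prop where
  conn : G.Connected
  acyc : G.IsAcyclic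
  deg : ∀ v : V, (G.neighborSet v).ncard = Q

/-- `A` is the adjacency operator of the simple graph `G` on ℓ²(V). -/
def IsAdjacencyOp {V : Type} (G : SimpleGraph V) (A : L2 V →L[ℂ] L2 V) : Prop :=
  ∀ x y : V, entry A x y = if G.Adj x y then 1 else 0

/-- `P` assigns to each subset `S ⊆ V` the orthogonal projection of ℓ²(V) onto ℓ²(S). -/
def IsProjFamily {V : Type} (P : Set V → (L2 V →L[ℂ] L2 V)) : Prop :=
  ∀ (S : Set V) (f : L2 V) (x : V),
    (P S f : ∀ _ : V, ℂ) x = if x ∈ S then (f : ∀ _ : V, ℂ) x else 0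

/-- `S` is the vertex set of a connected subtree of `G` in which every vertex has
exactly `q` neighbours within `S` (a subtree of constant internal degree `q`). -/
def IsRegularSubtree {V : Type} (G : SimpleGraph V) (S : Set V) (q : ℕ) : Prop :=
  (G.induce S).Connected ∧ ∀ x ∈ S, {y : V | y ∈ S ∧ G.Adj x y}.ncard = q

/-- Distance from a vertex to a set of vertices. -/
def distToSet {V : Type} (G : SimpleGraph V) (x : V) (S : Set V) : ℕ :=
  sInf {n : ℕ | ∃ y ∈ S, G.dist x y = n}

/-- `a(λ)` of equation (4.2) of the paper, for the tree of degree `Q`. -/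
def aF (Q : ℕ) (l : ℝ) : ℝ :=
  l * (1 - Real.sqrt (1 - 4 * ((Q : ℝ) - 1) / l ^ 2)) / (2 * ((Q : ℝ) - 1))

/-- `μ(λ)` of equation (4.3) of the paper, for the tree of degree `Q`. -/
def muF (Q : ℕ) (l : ℝ) : ℝ :=
  l * (((Q : ℝ) - 2) + (Q : ℝ) * Real.sqrt (1 - 4 * ((Q : ℝ) - 1) / l ^ 2)) /
    (2 * ((Q : ℝ) - 1))

/-- `M` realizes the inverse, within the corner algebra `P·B(ℓ²)·P`, of the operator
`P − P T P` (that is, of `I_{ℓ²(S)} − S(λ)` when `T` is the resolvent and `P = P_{ℓ²(S)}`). -/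
def IsCornerInverse {V : Type} (P M T : L2 V →L[ℂ] L2 V) : Prop :=
  P ∘L M = M ∧ M ∘L P = M ∧
    M ∘L (P - P ∘L T ∘L P) = P ∧ (P - P ∘L T ∘L P) ∘L M = P


section Tree

variable {V : Type} {G : SimpleGraph V}

theorem SimpleGraph.IsTree.exists_adj_dist_add_one_eq (hG : G.IsTree) {z x : V} (h : x ≠ z) :
    ∃ y, G.Adj x y ∧ G.dist z y + 1 = G.dist z x := by
  obtain ⟨p, hp⟩ := hG.connected.exists_walk_length_eq_dist x z
  cases p with
  | nil => exact absurd rfl h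
  | @cons _ y _ hxy q =>
    refine ⟨y, hxy, ?_⟩
    have h₁ : G.dist y z ≤ q.length := SimpleGraph.dist_le q
    rw [SimpleGraph.Walk.length_cons, SimpleGraph.dist_comm] at hp
    rw [SimpleGraph.dist_comm] at h₁
    rcases hG.dist_eq_dist_add_one_of_adj z hxy with h₂ | h₂ <;> omega

theorem SimpleGraph.IsTree.eq_of_adj_of_dist_add_one_eq (hG : G.IsTree) {z x y y' : V}
    (hy : G.Adj x y) (hy' : G.Adj x y') (hd : G.dist z y + 1 = G.dist z x)
    (hd' : G.dist z y' + 1 = G.dist z x) : y = y' := by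
  obtain ⟨p, hp⟩ := hG.connected.exists_walk_length_eq_dist y z
  obtain ⟨p', hp'⟩ := hG.connected.exists_walk_length_eq_dist y' z
  rw [SimpleGraph.dist_comm] at hp hp'
  have h : (SimpleGraph.Walk.cons hy p).IsPath := by
    apply SimpleGraph.Walk.isPath_of_length_eq_dist
    rw [SimpleGraph.Walk.length_cons, SimpleGraph.dist_comm, hp, hd]
  have h' : (SimpleGraph.Walk.cons hy' p').IsPath := by
    apply SimpleGraph.Walk.isPath_of_length_eq_dist
    rw [SimpleGraph.Walk.length_cons, SimpleGraph.dist_comm, hp', hd']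
  have := congrArg (fun q : G.Path x z => (q : G.Walk x z).snd)
    ((hG.isAcyclic.subsingleton_path x z).elim ⟨_, h⟩ ⟨_, h'⟩)
  simpa using this

theorem SimpleGraph.IsTree.dist_ray_add (hG : G.IsTree) {ray : ℕ → V}
    (hinj : Function.Injective ray) (hadj : ∀ k, G.Adj (ray k) (ray (k + 1))) (j n : ℕ) :
    G.dist (ray j) (ray (j + n)) = n := by
  induction n using Nat.strong_induction_on with
  | _ n ih =>
    match n with
    | 0 => simp
    | 1 => exact SimpleGraph.dist_eq_one_iff_adj.2 (hadj j)
    | n + 2 =>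
      have h₀ := ih n (by omega)
      have h₁ := ih (n + 1) (by omega)
      rcases hG.dist_eq_dist_add_one_of_adj (ray j) (hadj (j + (n + 1))) with h | h
      · have := hG.eq_of_adj_of_dist_add_one_eq (z := ray j) (hadj (j + (n + 1)))
          (hadj (j + n)).symm h.symm (by rw [h₀]; exact h₁.symm)
        have := hinj this
        omega
      · rw [h₁] at h
        exact h

theorem SimpleGraph.IsTree.dist_ray (hG : G.IsTree) {ray : ℕ → V}
    (hinj : Function.Injective ray) (hadj : ∀ k, G.Adj (ray k) (ray (k + 1))) (j k : ℕ) :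
    G.dist (ray j) (ray k) = (j - k) + (k - j) := by
  rcases le_total j k with h | h
  · obtain ⟨n, rfl⟩ := Nat.exists_eq_add_of_le h
    rw [hG.dist_ray_add hinj hadj]
    omega
  · obtain ⟨n, rfl⟩ := Nat.exists_eq_add_of_le h
    rw [SimpleGraph.dist_comm, hG.dist_ray_add hinj hadj]
    omega

variable {Q : ℕ} {N : V → Finset V}

/-- The sum of a function of the distance to `z` over the neighbours of a vertex other than `z`. -/
theorem SimpleGraph.IsTree.sum_neighbors_dist {M : Type*} [AddCommMonoid M] (hG : G.IsTree)
    (hN : ∀ x y, y ∈ N x ↔ G.Adj x y) (hcard : ∀ x, (N x).card = Q) {z x : V} {n : ℕ}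
    (hx : G.dist z x = n + 1) (φ : ℕ → M) :
    ∑ y ∈ N x, φ (G.dist z y) = φ n + (Q - 1) • φ (n + 2) := by
  have hne : x ≠ z := by
    rintro rfl
    simp at hx
  obtain ⟨y, hxy, hy⟩ := hG.exists_adj_dist_add_one_eq hne
  have hyN : y ∈ N x := (hN x y).2 hxy
  rw [← Finset.add_sum_erase _ _ hyN]
  congr 1
  · congr 1
    omega
  · rw [← hcard x, ← Finset.card_erase_of_mem hyN]
    apply Finset.sum_eq_card_nsmul
    intro w hw
    rw [Finset.mem_erase, hN] at hw
    rcases hG.dist_eq_dist_add_one_of_adj z hw.2 with h | h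
    · exact absurd (hG.eq_of_adj_of_dist_add_one_eq hw.2 hxy h.symm hy) hw.1
    · rw [h, hx]

theorem SimpleGraph.IsTree.sum_neighbors_dist_self {M : Type*} [AddCommMonoid M]
    (hN : ∀ x y, y ∈ N x ↔ G.Adj x y) (hcard : ∀ x, (N x).card = Q) (z : V) (φ : ℕ → M) :
    ∑ y ∈ N z, φ (G.dist z y) = Q • φ 1 := by
  rw [← hcard z]
  apply Finset.sum_eq_card_nsmul
  intro w hw
  rw [SimpleGraph.dist_eq_one_iff_adj.2 ((hN z w).1 hw)]

/-- The number of vertices at distance `n` from `z`, counted in `ℝ≥0∞`. -/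
def sphereCount (G : SimpleGraph V) (z : V) (n : ℕ) : ℝ≥0∞ :=
  ∑' x, if G.dist z x = n then 1 else 0

theorem sphereCount_zero (hG : G.IsTree) (z : V) : sphereCount G z 0 = 1 := by
  have : ∀ x, (if G.dist z x = 0 then (1 : ℝ≥0∞) else 0) = if x = z then 1 else 0 := by
    intro x
    simp only [hG.connected.dist_eq_zero_iff, eq_comm]
  simp only [sphereCount, this, tsum_ite_eq]

theorem sphereCount_succ_le (hG : G.IsTree) (hN : ∀ x y, y ∈ N x ↔ G.Adj x y) {z : V} {n c : ℕ}
    (hc : ∀ y, G.dist z y = n → ∑ x ∈ N y, (if G.dist z x = n + 1 then 1 else 0) ≤ c) :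
    sphereCount G z (n + 1) ≤ c * sphereCount G z n := by
  calc sphereCount G z (n + 1)
      ≤ ∑' x, ∑' y, if G.Adj x y ∧ G.dist z x = n + 1 ∧ G.dist z y = n then 1 else 0 := by
        refine ENNReal.tsum_le_tsum fun x => ?_
        split_ifs with hx
        · have hne : x ≠ z := by
            rintro rfl
            simp at hx
          obtain ⟨y, hxy, hy⟩ := hG.exists_adj_dist_add_one_eq hne
          refine le_trans ?_ (ENNReal.le_tsum y)
          rw [if_pos ⟨hxy, hx, by omega⟩]
        · exact zero_le
    _ = ∑' y, ∑' x, if G.Adj x y ∧ G.dist z x = n + 1 ∧ G.dist z y = n then 1 else 0 :=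
        ENNReal.tsum_comm
    _ ≤ ∑' y, (c : ℝ≥0∞) * if G.dist z y = n then 1 else 0 := by
        refine ENNReal.tsum_le_tsum fun y => ?_
        by_cases hy : G.dist z y = n
        · rw [tsum_eq_sum (s := N y)]
          · have h := hc y hy
            rw [if_pos hy, mul_one, ← ENNReal.coe_natCast]
            calc _ = ∑ x ∈ N y, (((if G.dist z x = n + 1 then 1 else 0 : ℕ)) : ℝ≥0∞) := by
                  refine Finset.sum_congr rfl fun x hx => ?_
                  have := ((hN y x).1 hx).symm
                  simp [this, hy]
              _ ≤ _ := by exact_mod_cast h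
          · intro x hx
            rw [hN] at hx
            exact if_neg fun h => hx h.1.symm
        · simp [hy]
    _ = _ := by rw [ENNReal.tsum_mul_left, sphereCount]

theorem sphereCount_le (hG : G.IsTree) (hN : ∀ x y, y ∈ N x ↔ G.Adj x y)
    (hcard : ∀ x, (N x).card = Q) (hQ : 2 ≤ Q) (z : V) (n : ℕ) :
    sphereCount G z n ≤ Q * ((Q - 1 : ℕ) : ℝ≥0∞) ^ n := by
  induction n with
  | zero =>
    rw [sphereCount_zero hG, pow_zero, mul_one]
    exact_mod_cast (by omega : 1 ≤ Q)
  | succ n ih =>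
    rcases n with _ | n
    · refine (sphereCount_succ_le hG hN (c := Q) fun y hy => ?_).trans ?_
      · rw [← hcard y, Finset.card_eq_sum_ones]
        exact Finset.sum_le_sum fun x _ => by split_ifs <;> simp
      · rw [sphereCount_zero hG, zero_add, pow_one]
        gcongr
        exact_mod_cast (by omega : 1 ≤ Q - 1)
    · refine (sphereCount_succ_le hG hN (c := Q - 1) fun y hy => ?_).trans ?_
      · rw [hG.sum_neighbors_dist hN hcard hy fun m => if m = n + 1 + 1 then 1 else 0]
        simp [show n ≠ n + 1 + 1 by omega]
      · calc _ ≤ ((Q - 1 : ℕ) : ℝ≥0∞) * (Q * ((Q - 1 : ℕ) : ℝ≥0∞) ^ (n + 1)) := by gcongr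
          _ = _ := by ring

theorem summable_pow_dist (hG : G.IsTree) (hN : ∀ x y, y ∈ N x ↔ G.Adj x y)
    (hcard : ∀ x, (N x).card = Q) (hQ : 2 ≤ Q) (z : V) {t : ℝ} (ht : 0 ≤ t)
    (htQ : ((Q : ℝ) - 1) * t < 1) : Summable fun x => t ^ G.dist z x := by
  lift t to NNReal using ht
  have htQ' : ((Q - 1 : ℕ) : NNReal) * t < 1 := by
    rw [← NNReal.coe_lt_coe]
    rw [NNReal.coe_mul, NNReal.coe_natCast, Nat.cast_sub (by omega), NNReal.coe_one, Nat.cast_one]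
    exact htQ
  have key : ∑' x, ((t ^ G.dist z x : NNReal) : ℝ≥0∞) ≠ ⊤ := by
    have h₁ : ∑' x, ((t ^ G.dist z x : NNReal) : ℝ≥0∞)
        = ∑' n, (t : ℝ≥0∞) ^ n * sphereCount G z n := by
      simp only [sphereCount, ← ENNReal.tsum_mul_left]
      rw [ENNReal.tsum_comm]
      refine tsum_congr fun x => ?_
      rw [tsum_eq_single (G.dist z x)]
      · simp
      · intro n hn
        simp [hn.symm]
    rw [h₁]
    have h₂ : ∑' n, (t : ℝ≥0∞) ^ n * sphereCount G z n
        ≤ ∑' n : ℕ, (Q : ℝ≥0∞) * ((((Q - 1 : ℕ) : NNReal) * t : NNReal) : ℝ≥0∞) ^ n := by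
      refine ENNReal.tsum_le_tsum fun n => ?_
      calc _ ≤ (t : ℝ≥0∞) ^ n * (Q * ((Q - 1 : ℕ) : ℝ≥0∞) ^ n) := by
            gcongr
            exact sphereCount_le hG hN hcard hQ z n
        _ = _ := by
            rw [ENNReal.coe_mul, mul_pow, ENNReal.coe_natCast]
            ring
    refine ne_top_of_le_ne_top ?_ h₂
    rw [ENNReal.tsum_mul_left, ENNReal.tsum_geometric]
    refine ENNReal.mul_ne_top (by simp) (ENNReal.inv_ne_top.2 ?_)
    rw [Ne, tsub_eq_zero_iff_le, not_le]
    exact_mod_cast htQ'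
  have := ENNReal.tsum_coe_ne_top_iff_summable.1 key
  exact_mod_cast NNReal.summable_coe.2 this

end Tree

section RealAnalysis

theorem hasSum_pow_dist_mul_pow {a r : ℝ} (ha : 0 < a) (hr : 0 < r) (har : a * r < 1) (hne : r ≠ a)
    (j : ℕ) : HasSum (fun k : ℕ => a ^ ((j - k) + (k - j)) * r ^ k)
      (a * (r ^ j - a ^ j) / (r - a) + r ^ j / (1 - a * r)) := by
  rw [← hasSum_nat_add_iff' j]
  have h₁ : ∑ k ∈ Finset.range j, a ^ ((j - k) + (k - j)) * r ^ k
      = a * (r ^ j - a ^ j) / (r - a) := by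
    rw [mul_div_assoc, ← geom₂_sum hne, Finset.mul_sum]
    refine Finset.sum_congr rfl fun k hk => ?_
    rw [Finset.mem_range] at hk
    rw [show (j - k) + (k - j) = (j - 1 - k) + 1 by omega, pow_succ]
    ring
  rw [h₁, add_sub_cancel_left, div_eq_mul_inv]
  have h₂ := (hasSum_geometric_of_lt_one (by positivity) har).mul_left (r ^ j)
  have h₃ (n : ℕ) : a ^ ((j - (n + j)) + (n + j - j)) * r ^ (n + j) = r ^ j * (a * r) ^ n := by
    rw [show (j - (n + j)) + (n + j - j) = n by omega, pow_add, mul_pow]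
    ring
  simpa only [h₃] using h₂

/-- The geometric sequence `(r / a - 1) r ^ j` solves the compressed resolvent equation on a ray. -/
theorem ray_equation {a r : ℝ} (ha : 0 < a) (ha1 : a < 1) (hr : 0 < r) (har : a * r < 1)
    (hne : r ≠ a) (h : r + 1 / r = a + 1 / a - 1) (j : ℕ) :
    a / (1 - a ^ 2) * (a ^ j + (r / a - 1) *
      (a * (r ^ j - a ^ j) / (r - a) + r ^ j / (1 - a * r))) = (r / a - 1) * r ^ j := by
  have h₁ : r - a ≠ 0 := sub_ne_zero.2 hne
  have h₂ : 1 - a * r ≠ 0 := by linarith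
  have h₃ : 1 - a ^ 2 ≠ 0 := by nlinarith
  have h₄ : a * r ^ 2 + a = r * a ^ 2 + r - a * r := by
    field_simp at h
    linarith
  field_simp
  generalize r ^ j = s
  generalize a ^ j = b
  grind

theorem aF_spec {Q : ℕ} (hQ : 3 ≤ Q) {l : ℝ} (hl : 0 < l) (hlQ : 4 * ((Q : ℝ) - 1) < l ^ 2) :
    0 < aF Q l ∧ ((Q : ℝ) - 1) * aF Q l ^ 2 < 1 ∧ l = 1 / aF Q l + ((Q : ℝ) - 1) * aF Q l := by
  have hq : (2 : ℝ) ≤ (Q : ℝ) - 1 := by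
    have : (3 : ℝ) ≤ Q := by exact_mod_cast hQ
    linarith
  rw [aF]
  generalize (Q : ℝ) - 1 = q at *
  have hD : 0 < 1 - 4 * q / l ^ 2 := by
    rw [sub_pos, div_lt_one (by positivity)]
    exact hlQ
  have hs := Real.sqrt_pos.2 hD
  have hs2 := Real.sq_sqrt hD.le
  have hs1 : Real.sqrt (1 - 4 * q / l ^ 2) < 1 := by
    rw [Real.sqrt_lt' one_pos]
    have : 0 < 4 * q / l ^ 2 := by positivity
    linarith
  generalize Real.sqrt (1 - 4 * q / l ^ 2) = s at *
  have h4 : l ^ 2 * (1 - s ^ 2) = 4 * q := by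
    rw [hs2]
    field_simp
    ring
  have hpos : 0 < l * (1 - s) / (2 * q) := by
    have : 0 < 1 - s := by linarith
    positivity
  refine ⟨hpos, ?_, ?_⟩
  · have : q * (l * (1 - s) / (2 * q)) ^ 2 = l ^ 2 * (1 - s) ^ 2 / (4 * q) := by
      field_simp
      ring
    rw [this, div_lt_one (by positivity), ← h4]
    have : 0 < l ^ 2 := by positivity
    nlinarith [mul_pos this (mul_pos hs (sub_pos.2 hs1))]
  · have h1s : 1 - s ≠ 0 := by linarith
    field_simp
    linear_combination h4

theorem continuousAt_aF (Q : ℕ) {l : ℝ} (hl : l ≠ 0) : ContinuousAt (aF Q) l := by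
  unfold aF
  have : l ^ 2 ≠ 0 := pow_ne_zero _ hl
  fun_prop (disch := assumption)

theorem lt_of_inv_add_mul_lt {q x y : ℝ} (hx : 0 < x) (hy : 0 < y) (hxq : q * x ^ 2 < 1)
    (hyq : q * y ^ 2 < 1) (h : 1 / y + q * y < 1 / x + q * x) : x < y := by
  by_contra! hle
  have h₁ : 1 / x + q * x - (1 / y + q * y) = (y - x) * (1 - q * (x * y)) / (x * y) := by
    field_simp
    ring
  have h₂ : q * (x * y) < 1 := by
    rcases le_total q 0 with hq | hq
    · nlinarith [mul_pos hx hy, mul_nonneg (neg_nonneg.2 hq) (mul_pos hx hy).le]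
    · nlinarith [mul_nonneg hq (sq_nonneg (x - y))]
  have h₃ : (y - x) * (1 - q * (x * y)) / (x * y) ≤ 0 :=
    div_nonpos_of_nonpos_of_nonneg
      (mul_nonpos_of_nonpos_of_nonneg (by linarith) (by linarith)) (by positivity)
  linarith

/-- The decay rate along the ray: the smaller root of `r + 1 / r = a + 1 / a - 1`. -/
def rayRate (a : ℝ) : ℝ :=
  ((a + 1 / a - 1) - Real.sqrt ((a + 1 / a - 1) ^ 2 - 4)) / 2

theorem rayRate_spec {a : ℝ} (ha : 0 < a) (ha1 : a < 1) (h : 3 < a + 1 / a) :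
    a < rayRate a ∧ rayRate a < 1 ∧ rayRate a + 1 / rayRate a = a + 1 / a - 1 := by
  rw [rayRate]
  have hb : 2 < a + 1 / a - 1 := by linarith
  have hab : a * (a + 1 / a - 1) = a ^ 2 + 1 - a := by
    field_simp
  generalize a + 1 / a - 1 = b at *
  have hD : 0 < b ^ 2 - 4 := by nlinarith
  have hs2 := Real.sq_sqrt hD.le
  have hs := Real.sqrt_pos.2 hD
  generalize Real.sqrt (b ^ 2 - 4) = s at *
  have hsb : s < b := by nlinarith
  refine ⟨?_, ?_, ?_⟩
  · have : s < b - 2 * a := by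
      apply lt_of_pow_lt_pow_left₀ 2
      · nlinarith
      · nlinarith
    linarith
  · nlinarith
  · have : b - s ≠ 0 := by linarith
    field_simp
    linear_combination hs2

theorem continuousAt_rayRate {a : ℝ} (ha : a ≠ 0) : ContinuousAt rayRate a := by
  unfold rayRate
  fun_prop (disch := assumption)

/-- The critical value of `a`: the smaller root of `a ^ 2 - 3 * a + 1`. -/
def aCrit : ℝ := (3 - Real.sqrt 5) / 2

theorem aCrit_sq : aCrit ^ 2 - 3 * aCrit + 1 = 0 := by
  rw [aCrit]
  linear_combination (1 / 4 : ℝ) * Real.sq_sqrt (show (0 : ℝ) ≤ 5 by norm_num)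

theorem aCrit_bounds : 0.38 < aCrit ∧ aCrit < 0.382 := by
  have h₁ : Real.sqrt 5 < 2.24 := by
    rw [Real.sqrt_lt' (by norm_num)]
    norm_num
  have h₂ : 2.236 < Real.sqrt 5 := by
    rw [Real.lt_sqrt (by norm_num)]
    norm_num
  rw [aCrit]
  constructor <;> linarith

theorem lamstar_eq (q : ℝ) :
    (3 - Real.sqrt 5) * q / 2 + Real.sqrt 5 = 1 / aCrit + (q - 1) * aCrit := by
  have h : 1 / aCrit = 3 - aCrit := by
    have := aCrit_sq
    have := aCrit_bounds.1
    field_simp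
    linarith
  rw [h, aCrit]
  ring

theorem four_mul_lt_sq_inv_add_mul {q x : ℝ} (hx : 0 < x) (hxq : q * x ^ 2 < 1) :
    4 * q < (1 / x + q * x) ^ 2 := by
  have : (1 / x + q * x) ^ 2 - 4 * q = ((1 - q * x ^ 2) / x) ^ 2 := by
    field_simp
    ring
  have h : 0 < (1 - q * x ^ 2) / x := div_pos (by linarith) hx
  nlinarith [pow_pos h 2]

theorem eq_of_inv_add_mul_eq {q x y : ℝ} (hx : 0 < x) (hy : 0 < y) (hxq : q * x ^ 2 < 1)
    (hyq : q * y ^ 2 < 1) (h : 1 / y + q * y = 1 / x + q * x) : x = y := by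
  have h₁ : (y - x) * (1 - q * (x * y)) = 0 := by
    field_simp at h
    linear_combination (-1 : ℝ) * h
  have h₂ : q * (x * y) < 1 := by
    rcases le_total q 0 with hq | hq
    · nlinarith [mul_pos hx hy, mul_nonneg (neg_nonneg.2 hq) (mul_pos hx hy).le]
    · nlinarith [mul_nonneg hq (sq_nonneg (x - y))]
  rcases mul_eq_zero.1 h₁ with h₃ | h₃ <;> linarith

end RealAnalysis

section Algebra

variable {R : Type*} [Ring R] {p x u r r' : R}

theorem resolvent_identities (h₁ : r * u = 1) (h₂ : u * r = 1) (h₁' : r' * (u - p) = 1)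
    (h₂' : (u - p) * r' = 1) : r' = r + r * p * r' ∧ r' = r + r' * p * r := by
  constructor
  · calc r' = r * u * r' := by rw [h₁, one_mul]
      _ = r * ((u - p) * r') + r * p * r' := by noncomm_ring
      _ = _ := by rw [h₂', mul_one]
  · calc r' = r' * (u * r) := by rw [h₂, mul_one]
      _ = r' * (u - p) * r + r' * p * r := by noncomm_ring
      _ = _ := by rw [h₁', one_mul]

theorem corner_mul_right (hp : p * p = p) (h : r' = r + r * p * r') :
    (p - p * r * p) * (p + p * r' * p) = p := by
  calc (p - p * r * p) * (p + p * r' * p)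
      = p * p + (p * p) * r' * p - p * r * (p * p) - p * r * (p * p) * r' * p := by noncomm_ring
    _ = p + p * (r' - r - r * p * r') * p := by
        rw [hp]
        noncomm_ring
    _ = p := by
        rw [sub_sub, sub_eq_zero.2 h]
        simp

theorem corner_mul_left (hp : p * p = p) (h : r' = r + r' * p * r) :
    (p + p * r' * p) * (p - p * r * p) = p := by
  calc (p + p * r' * p) * (p - p * r * p)
      = p * p + p * r' * (p * p) - p * p * r * p - p * r' * (p * p) * r * p := by noncomm_ring
    _ = p + p * (r' - r - r' * p * r) * p := by
        rw [hp]
        noncomm_ring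
    _ = p := by
        rw [sub_sub, sub_eq_zero.2 h]
        simp

theorem resolvent_eq_of_corner (h : r' = r + r * p * r') (h' : r' = r + r' * p * r) :
    r' = r * (1 + (p + p * r' * p) * r) := by
  calc r' = r + r * p * r' := h
    _ = r + r * p * (r + r' * p * r) := by rw [← h']
    _ = _ := by noncomm_ring

end Algebra

section Operators

variable {V : Type}

theorem delta_apply (x y : V) : (delta x : ∀ _ : V, ℂ) y = if y = x then 1 else 0 := by
  rw [delta, lp.single_apply, Pi.single_apply]

theorem norm_delta (x : V) : ‖delta x‖ = 1 := by
  rw [delta, lp.norm_single (by norm_num), norm_one]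

theorem inner_delta_left (x : V) (f : L2 V) : inner ℂ (delta x) f = (f : ∀ _ : V, ℂ) x := by
  rw [delta, lp.inner_single_left]
  simp

theorem L2.sum_apply {ι : Type*} (s : Finset ι) (F : ι → L2 V) (x : V) :
    ((∑ i ∈ s, F i : L2 V) : ∀ _ : V, ℂ) x = ∑ i ∈ s, (F i : ∀ _ : V, ℂ) x := by
  rw [lp.coeFn_sum, _root_.Finset.sum_apply]

variable {G : SimpleGraph V} {N : V → Finset V} {A : L2 V →L[ℂ] L2 V}

theorem adjacencyOp_apply (hA : IsAdjacencyOp G A) (hsa : IsSelfAdjoint A)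
    (hN : ∀ x y, y ∈ N x ↔ G.Adj x y) (f : L2 V) (x : V) :
    (A f : ∀ _ : V, ℂ) x = ∑ y ∈ N x, (f : ∀ _ : V, ℂ) y := by
  have h : A (delta x) = ∑ y ∈ N x, delta y := by
    ext z
    rw [L2.sum_apply]
    simp only [delta_apply, Finset.sum_ite_eq, hN]
    rw [G.adj_comm]
    exact hA z x
  have hs : inner ℂ (A (delta x)) f = inner ℂ (delta x) (A f) := hsa.isSymmetric _ _
  rw [← inner_delta_left, ← hs, h, sum_inner]
  simp only [inner_delta_left]

variable {P : Set V → (L2 V →L[ℂ] L2 V)}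

/-- The norm of an adjacency operator does not exceed the norm of its sum with a projection. -/
theorem norm_adjacencyOp_le (hA : IsAdjacencyOp G A) (hsa : IsSelfAdjoint A)
    (hN : ∀ x y, y ∈ N x ↔ G.Adj x y) (hP : IsProjFamily P) (S : Set V) :
    ‖A‖ ≤ ‖A + P S‖ := by
  refine A.opNorm_le_bound (norm_nonneg _) fun f => ?_
  have hmem : Memℓp (fun x => ((‖(f : ∀ _ : V, ℂ) x‖ : ℝ) : ℂ)) 2 := by
    have := lp.memℓp f
    rw [memℓp_gen_iff (by norm_num)] at this ⊢
    simpa using this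
  have hle : ‖(⟨_, hmem⟩ : L2 V)‖ ≤ ‖f‖ := lp.norm_mono (by norm_num) fun x => by simp
  refine le_trans ?_ ((A + P S).le_opNorm_of_le hle)
  refine lp.norm_mono (by norm_num) fun x => ?_
  have h : (((A + P S) ⟨_, hmem⟩ : L2 V) : ∀ _ : V, ℂ) x
      = ((∑ y ∈ N x, ‖(f : ∀ _ : V, ℂ) y‖ + if x ∈ S then ‖(f : ∀ _ : V, ℂ) x‖ else 0 : ℝ) : ℂ) := by
    rw [add_apply, lp.coeFn_add, Pi.add_apply, adjacencyOp_apply hA hsa hN, hP]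
    split_ifs <;> push_cast <;> rfl
  have h₀ : 0 ≤ if x ∈ S then ‖(f : ∀ _ : V, ℂ) x‖ else 0 := by positivity
  rw [h, adjacencyOp_apply hA hsa hN, Complex.norm_real]
  refine le_trans (norm_sum_le _ _) (le_trans ?_ (le_abs_self _))
  linarith

theorem isUnit_smul_one_sub {B : L2 V →L[ℂ] L2 V} {l : ℝ} (h : ‖B‖ < l) :
    IsUnit ((l : ℂ) • (1 : L2 V →L[ℂ] L2 V) - B) := by
  have hl : ‖B‖ * ‖(1 : L2 V →L[ℂ] L2 V)‖ < ‖(l : ℂ)‖ := by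
    rw [Complex.norm_real]
    refine lt_of_le_of_lt ?_ (h.trans_le (le_abs_self l))
    exact mul_le_of_le_one_right (norm_nonneg _) ContinuousLinearMap.norm_id_le
  have := spectrum.mem_resolventSet_of_norm_lt_mul hl
  rwa [spectrum.mem_resolventSet_iff, Algebra.algebraMap_eq_smul_one] at this

theorem ResR_mul {B : L2 V →L[ℂ] L2 V} {l : ℝ} (h : ‖B‖ < l) :
    ResR B l * ((l : ℂ) • (1 : L2 V →L[ℂ] L2 V) - B) = 1 :=
  Ring.inverse_mul_cancel _ (isUnit_smul_one_sub h)

theorem mul_ResR {B : L2 V →L[ℂ] L2 V} {l : ℝ} (h : ‖B‖ < l) :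
    ((l : ℂ) • (1 : L2 V →L[ℂ] L2 V) - B) * ResR B l = 1 :=
  Ring.mul_inverse_cancel _ (isUnit_smul_one_sub h)

theorem ResR_apply_eq {B : L2 V →L[ℂ] L2 V} {l : ℝ} (h : ‖B‖ < l) {f g : L2 V}
    (hfg : (l : ℂ) • g - B g = f) : ResR B l f = g := by
  rw [← hfg]
  exact congrArg (fun T : L2 V →L[ℂ] L2 V => T g) (ResR_mul h)

theorem smul_sub_ResR_apply {B : L2 V →L[ℂ] L2 V} {l : ℝ} (h : ‖B‖ < l) (f : L2 V) :
    (l : ℂ) • ResR B l f - B (ResR B l f) = f :=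
  congrArg (fun T : L2 V →L[ℂ] L2 V => T f) (mul_ResR h)

theorem projFamily_mul_self (hP : IsProjFamily P) (S : Set V) : P S * P S = P S := by
  ext f x
  rw [mul_apply_eq_comp, hP, hP]
  split_ifs <;> rfl

theorem exists_cornerInverse (hP : IsProjFamily P) (S : Set V) {l : ℝ} (h : ‖A‖ < l)
    (h' : ‖A + P S‖ < l) : ∃ M : L2 V →L[ℂ] L2 V, IsCornerInverse (P S) M (ResR A l) ∧
      ResR (A + P S) l = ResR A l ∘L ((1 : L2 V →L[ℂ] L2 V) + M ∘L ResR A l) := by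
  have hp := projFamily_mul_self hP S
  obtain ⟨h₁, h₂⟩ := resolvent_identities (p := P S) (ResR_mul h) (mul_ResR h)
    (by rw [sub_sub]; exact ResR_mul h') (by rw [sub_sub]; exact mul_ResR h')
  refine ⟨P S + P S * ResR (A + P S) l * P S, ⟨?_, ?_, ?_, ?_⟩, resolvent_eq_of_corner h₁ h₂⟩
  · change P S * (P S + P S * ResR (A + P S) l * P S) = _
    rw [mul_add, ← mul_assoc, ← mul_assoc, hp]
  · change (P S + P S * ResR (A + P S) l * P S) * P S = _
    rw [add_mul, mul_assoc _ (P S) (P S), hp]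
  · exact corner_mul_left hp h₂
  · exact corner_mul_right hp h₁

end Operators

section Resolvent

variable {V : Type} {G : SimpleGraph V} {Q : ℕ} {N : V → Finset V} {A : L2 V →L[ℂ] L2 V}

theorem memℓp_pow_dist (hG : G.IsTree) (hN : ∀ x y, y ∈ N x ↔ G.Adj x y)
    (hcard : ∀ x, (N x).card = Q) (hQ : 2 ≤ Q) (z : V) {a : ℝ} (ha : 0 < a)
    (haQ : ((Q : ℝ) - 1) * a ^ 2 < 1) :
    Memℓp (fun x => ((a ^ G.dist z x : ℝ) : ℂ)) 2 := by
  rw [memℓp_gen_iff (by norm_num)]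
  refine (summable_pow_dist hG hN hcard hQ z (sq_nonneg a) haQ).congr fun x => ?_
  rw [Complex.norm_real, Real.norm_of_nonneg (by positivity), ENNReal.toReal_ofNat,
    Real.rpow_ofNat, pow_right_comm]

/-- The resolvent of the homogeneous tree decays geometrically in the distance. -/
theorem ResR_delta_apply (hG : G.IsTree) (hA : IsAdjacencyOp G A) (hsa : IsSelfAdjoint A)
    (hN : ∀ x y, y ∈ N x ↔ G.Adj x y) (hcard : ∀ x, (N x).card = Q) (hQ : 2 ≤ Q) {a l : ℝ}
    (ha : 0 < a) (haQ : ((Q : ℝ) - 1) * a ^ 2 < 1) (hl : l = 1 / a + ((Q : ℝ) - 1) * a)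
    (h : ‖A‖ < l) (z x : V) :
    (ResR A l (delta z) : ∀ _ : V, ℂ) x = ((a / (1 - a ^ 2) * a ^ G.dist z x : ℝ) : ℂ) := by
  have hmem := memℓp_pow_dist hG hN hcard hQ z ha haQ
  have hQ' : (2 : ℝ) ≤ Q := by exact_mod_cast hQ
  have ha1 : 1 - a ^ 2 ≠ 0 := by nlinarith [sq_nonneg a]
  have hsol : (l : ℂ) • (((a / (1 - a ^ 2) : ℝ) : ℂ) • (⟨_, hmem⟩ : L2 V))
      - A (((a / (1 - a ^ 2) : ℝ) : ℂ) • (⟨_, hmem⟩ : L2 V)) = delta z := by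
    ext y
    rw [map_smul, lp.coeFn_sub, Pi.sub_apply, lp.coeFn_smul, Pi.smul_apply, lp.coeFn_smul,
      Pi.smul_apply, lp.coeFn_smul, Pi.smul_apply, adjacencyOp_apply hA hsa hN, delta_apply]
    change (l : ℂ) * (((a / (1 - a ^ 2) : ℝ) : ℂ) * ((a ^ G.dist z y : ℝ) : ℂ))
      - ((a / (1 - a ^ 2) : ℝ) : ℂ) * ∑ w ∈ N y, ((a ^ G.dist z w : ℝ) : ℂ) = _
    rw [← Complex.ofReal_sum]
    have key : l * (a / (1 - a ^ 2) * a ^ G.dist z y)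
        - a / (1 - a ^ 2) * ∑ w ∈ N y, a ^ G.dist z w = if y = z then 1 else 0 := by
      by_cases hyz : y = z
      · subst hyz
        rw [SimpleGraph.IsTree.sum_neighbors_dist_self hN hcard y fun n => a ^ n, hl]
        simp only [SimpleGraph.dist_self, nsmul_eq_mul, if_true]
        field_simp
        ring
      · obtain ⟨n, hn⟩ := Nat.exists_eq_succ_of_ne_zero
          (hG.connected.pos_dist_of_ne (Ne.symm hyz)).ne'
        rw [hG.sum_neighbors_dist hN hcard hn fun n => a ^ n, hl, hn, if_neg hyz, nsmul_eq_mul,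
          Nat.cast_sub (by omega)]
        rw [Nat.succ_eq_add_one]
        field_simp
        push_cast
        ring
    have := congrArg (fun t : ℝ => (t : ℂ)) key
    rw [apply_ite Complex.ofReal, Complex.ofReal_one, Complex.ofReal_zero] at this
    push_cast at this ⊢
    exact this
  rw [ResR_apply_eq h hsol, lp.coeFn_smul, Pi.smul_apply, Complex.ofReal_mul]
  rfl

variable {P : Set V → (L2 V →L[ℂ] L2 V)} {ray : ℕ → V}

/-- The diagonal entry at the root of the resolvent of the tree with loops along a ray. -/
theorem entry_ResR_ray_zero (hG : G.IsTree) (hA : IsAdjacencyOp G A) (hsa : IsSelfAdjoint A)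
    (hN : ∀ x y, y ∈ N x ↔ G.Adj x y) (hcard : ∀ x, (N x).card = Q) (hQ : 2 ≤ Q)
    (hP : IsProjFamily P) (hinj : Function.Injective ray)
    (hadj : ∀ k, G.Adj (ray k) (ray (k + 1))) {a r l : ℝ} (ha : 0 < a)
    (haQ : ((Q : ℝ) - 1) * a ^ 2 < 1) (hl : l = 1 / a + ((Q : ℝ) - 1) * a) (har : a < r)
    (hr1 : r < 1) (hr : r + 1 / r = a + 1 / a - 1) (h : ‖A‖ < l)
    (h' : ‖A + P (range ray)‖ < l) :
    entry (ResR (A + P (range ray)) l) (ray 0) (ray 0) = ((r / a - 1 : ℝ) : ℂ) := by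
  have hr0 : 0 < r := ha.trans har
  have hsum : Summable fun k : ℕ => (((r / a - 1) * r ^ k : ℝ) : ℂ) • delta (ray k) := by
    refine Summable.of_norm ?_
    simp only [norm_smul, norm_delta, mul_one, Complex.norm_real, norm_mul, norm_pow]
    refine (summable_geometric_of_lt_one (norm_nonneg r) ?_).mul_left _
    rwa [Real.norm_of_nonneg hr0.le]
  obtain ⟨w, hw⟩ := hsum
  have heval (T : L2 V →L[ℂ] L2 V) (x : V) : HasSum (fun k : ℕ =>
      (((r / a - 1) * r ^ k : ℝ) : ℂ) * (T (delta (ray k)) : ∀ _ : V, ℂ) x)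
      ((T w : ∀ _ : V, ℂ) x) := by
    have := ((innerSL ℂ (delta x)).comp T).hasSum hw
    simpa only [ContinuousLinearMap.comp_apply, Function.comp_def, map_smul, innerSL_apply_apply,
      inner_delta_left, smul_eq_mul] using this
  have hw_ray (j : ℕ) : (w : ∀ _ : V, ℂ) (ray j) = (((r / a - 1) * r ^ j : ℝ) : ℂ) := by
    refine (heval 1 (ray j)).unique ?_
    convert! hasSum_ite_eq j (((r / a - 1) * r ^ j : ℝ) : ℂ) using 2 with k
    rw [one_apply_eq_self, delta_apply, hinj.eq_iff]
    by_cases hk : k = j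
    · simp [hk]
    · simp [hk, Ne.symm hk]
  have hw_off {x : V} (hx : x ∉ range ray) : (w : ∀ _ : V, ℂ) x = 0 := by
    refine (heval 1 x).unique ?_
    convert! hasSum_zero using 2 with k
    rw [one_apply_eq_self, delta_apply, if_neg (fun hk => hx ⟨k, hk.symm⟩), mul_zero]
  have hg_ray (j : ℕ) : (ResR A l (delta (ray 0) + w) : ∀ _ : V, ℂ) (ray j)
      = (((r / a - 1) * r ^ j : ℝ) : ℂ) := by
    have hsumR := ((hasSum_pow_dist_mul_pow ha hr0 (by nlinarith) har.ne' j).mul_left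
      (a / (1 - a ^ 2) * (r / a - 1)))
    have hRw : (ResR A l w : ∀ _ : V, ℂ) (ray j) = ((a / (1 - a ^ 2) * (r / a - 1) *
        (a * (r ^ j - a ^ j) / (r - a) + r ^ j / (1 - a * r)) : ℝ) : ℂ) := by
      refine (heval (ResR A l) (ray j)).unique ?_
      convert! Complex.hasSum_ofReal.2 hsumR using 2 with k
      rw [ResR_delta_apply hG hA hsa hN hcard hQ ha haQ hl h, hG.dist_ray hinj hadj,
        add_comm (k - j)]
      push_cast
      ring
    rw [map_add, lp.coeFn_add, Pi.add_apply, hRw,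
      ResR_delta_apply hG hA hsa hN hcard hQ ha haQ hl h, hG.dist_ray hinj hadj,
      ← Complex.ofReal_add, ← ray_equation ha (har.trans hr1) hr0 (by nlinarith) har.ne' hr j]
    congr 1
    rw [Nat.zero_sub, zero_add, Nat.sub_zero]
    ring
  have hPg : P (range ray) (ResR A l (delta (ray 0) + w)) = w := by
    ext x
    rw [hP]
    split_ifs with hx
    · obtain ⟨j, rfl⟩ := hx
      rw [hg_ray, hw_ray]
    · exact (hw_off hx).symm
  have hres : ResR (A + P (range ray)) l (delta (ray 0)) = ResR A l (delta (ray 0) + w) := by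
    refine ResR_apply_eq h' ?_
    rw [add_apply, hPg, ← sub_sub, smul_sub_ResR_apply h, add_sub_cancel_right]
  rw [entry, hres, hg_ray, pow_zero, mul_one]

end Resolvent

/-- **Theorem 5.3.** For `3 ≤ Q ≤ 7`, with `N` a one-sided infinite geodesic ray starting
at the root `x_0 = ray 0`, `A_{ℍ^Q} = A + P_{ℓ²(N)}` and `λ* = ‖A_{ℍ^Q}‖ = (3−√5)Q/2 + √5`:
for every `λ > λ*` the operator `I_{ℓ²(N)} − S(λ)` is invertible (witnessed by its corner
inverse `M`) and `R_{A_{ℍ^Q}}(λ) = R_A(λ)[I + P_{ℓ²(N)}(I − S(λ))⁻¹ P_{ℓ²(N)} R_A(λ)]`;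
moreover `A_{ℍ^Q}` is transient, with
`lim_{λ ↓ λ*} ⟨R_{A_{ℍ^Q}}(λ)δ_0, δ_0⟩ = (1 − a(λ*))/a(λ*) < ∞`. -/
theorem resolvent_and_transience_HQ (Q : ℕ) (hQ3 : 3 ≤ Q) (hQ7 : Q ≤ 7)
    {V : Type} (G : SimpleGraph V) (hG : IsCayleyTree G Q)
    (A : L2 V →L[ℂ] L2 V) (hA : IsAdjacencyOp G A) (hsa : IsSelfAdjoint A)
    (P : Set V → (L2 V →L[ℂ] L2 V)) (hP : IsProjFamily P)
    (ray : ℕ → V) (hinj : Function.Injective ray)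
    (hadj : ∀ k : ℕ, G.Adj (ray k) (ray (k + 1)))
    (lamstar : ℝ) (hls : lamstar = (3 - Real.sqrt 5) * (Q : ℝ) / 2 + Real.sqrt 5)
    (hnorm : ‖A + P (Set.range ray)‖ = lamstar) :
    (∀ l : ℝ, lamstar < l →
      ∃ M : L2 V →L[ℂ] L2 V, IsCornerInverse (P (Set.range ray)) M (ResR A l) ∧
        ResR (A + P (Set.range ray)) l =
          ResR A l ∘L ((1 : L2 V →L[ℂ] L2 V) + M ∘L ResR A l))
    ∧ Tendsto (fun l : ℝ => entry (ResR (A + P (Set.range ray)) l) (ray 0) (ray 0))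
        (𝓝[>] lamstar)
        (𝓝 (((1 - aF Q lamstar) / aF Q lamstar : ℝ) : ℂ)) := by
  have htree : G.IsTree := ⟨hG.conn, hG.acyc⟩
  have hfin (x : V) : (G.neighborSet x).Finite :=
    finite_of_ncard_ne_zero (by rw [hG.deg]; omega)
  obtain ⟨N, hN, hcard⟩ : ∃ N : V → Finset V, (∀ x y, y ∈ N x ↔ G.Adj x y) ∧
      ∀ x, (N x).card = Q :=
    ⟨fun x => (hfin x).toFinset, by simp, fun x => by
      rw [← ncard_eq_toFinset_card _ (hfin x), hG.deg]⟩
  have hAle : ‖A‖ ≤ lamstar := hnorm ▸ norm_adjacencyOp_le hA hsa hN hP (range ray)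
  refine ⟨fun l hl => exists_cornerInverse hP _ (hAle.trans_lt hl) (hnorm.trans_lt hl), ?_⟩
  have hQ3' : (3 : ℝ) ≤ Q := by exact_mod_cast hQ3
  have hQ7' : (Q : ℝ) ≤ 7 := by exact_mod_cast hQ7
  obtain ⟨hc₁, hc₂⟩ := aCrit_bounds
  have hc₀ : 0 < aCrit := by linarith
  have hcQ : ((Q : ℝ) - 1) * aCrit ^ 2 < 1 := by nlinarith
  have hstar : lamstar = 1 / aCrit + ((Q : ℝ) - 1) * aCrit := hls.trans (lamstar_eq Q)
  have hpos : 0 < lamstar := by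
    rw [hstar]
    have : 0 < (Q : ℝ) - 1 := by linarith
    positivity
  have hsq : 4 * ((Q : ℝ) - 1) < lamstar ^ 2 := hstar ▸ four_mul_lt_sq_inv_add_mul hc₀ hcQ
  have haF : aF Q lamstar = aCrit := by
    obtain ⟨h₀, h₁, h₂⟩ := aF_spec hQ3 hpos hsq
    exact eq_of_inv_add_mul_eq h₀ hc₀ h₁ hcQ (hstar.symm.trans h₂)
  have hcrit : aCrit + 1 / aCrit = 3 := by
    have := aCrit_sq
    field_simp
    linarith
  have hrate : rayRate aCrit = 1 := by
    rw [rayRate, hcrit]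
    norm_num
  have heq : ∀ l ∈ Ioi lamstar, ((rayRate (aF Q l) / aF Q l - 1 : ℝ) : ℂ)
      = entry (ResR (A + P (range ray)) l) (ray 0) (ray 0) := by
    intro l hl
    rw [mem_Ioi] at hl
    obtain ⟨h₀, h₁, h₂⟩ := aF_spec hQ3 (hpos.trans hl) (hsq.trans (by gcongr))
    have hlt : aF Q l < aCrit := lt_of_inv_add_mul_lt h₀ hc₀ h₁ hcQ (by linarith)
    have h3 : 3 < aF Q l + 1 / aF Q l := by
      have h₄ : aF Q l + 1 / aF Q l - 3
          = (aCrit - aF Q l) * (1 - aF Q l * aCrit) / (aF Q l * aCrit) := by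
        rw [← hcrit]
        field_simp
        ring
      have : 0 < (aCrit - aF Q l) * (1 - aF Q l * aCrit) / (aF Q l * aCrit) :=
        div_pos (mul_pos (by linarith) (by nlinarith)) (by positivity)
      linarith
    obtain ⟨hr₁, hr₂, hr₃⟩ := rayRate_spec h₀ (by linarith) h3
    exact (entry_ResR_ray_zero htree hA hsa hN hcard (by omega) hP hinj hadj h₀ h₁ h₂ hr₁ hr₂ hr₃
      (hAle.trans_lt hl) (hnorm.trans_lt hl)).symm
  refine Tendsto.congr' (eventually_nhdsWithin_of_forall heq) ?_
  have hlim : (1 - aF Q lamstar) / aF Q lamstar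
      = rayRate (aF Q lamstar) / aF Q lamstar - 1 := by
    rw [haF, hrate]
    field_simp
  rw [hlim]
  have hca := continuousAt_aF Q hpos.ne'
  have hne : aF Q lamstar ≠ 0 := haF ▸ hc₀.ne'
  have hcont : ContinuousAt (fun l => rayRate (aF Q l) / aF Q l - 1) lamstar :=
    (((continuousAt_rayRate hne).comp hca).div hca hne).sub continuousAt_const
  exact (Complex.continuous_ofReal.continuousAt.comp hcont).tendsto.mono_left nhdsWithin_le_nhds
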